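/- For j ≥ 0, the two-dimensional Riemann sum ζ^n_{H,j} := n^{j-2} · Σ_{k ∈ ℤ²\{0}, n ≤ |k| ≤ 2n} 1/|k|^j converges as n → ∞ to ζ_{H,j} := 2π log 2 if j = 2 and 2π(2^{2-j} − 1)/(2 − j) if j ≠ 2, with error O(n^{-1}). -/

import Mathlib

open scoped BigOperators Classical

/-- Euclidean norm of an integer lattice point in `ℤ²`. -/
noncomputable def nrm2 (k : Fin 2 → ℤ) : ℝ :=
  Real.sqrt (((k 0 : ℝ)) ^ 2 + ((k 1 : ℝ)) ^ 2)

/-- The 2D Riemann sum `ζ^n_{H,j} = n^{j-2} Σ_{k ∈ ℤ²\{0}, n ≤ |k| ≤ 2n} |k|^{-j}`. -/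
noncomputable def zetaH (n : ℕ) (j : ℝ) : ℝ :=
  (n : ℝ) ^ (j - 2) *
    ∑' k : Fin 2 → ℤ,
      if k ≠ 0 ∧ (n : ℝ) ≤ nrm2 k ∧ nrm2 k ≤ 2 * n then nrm2 k ^ (-j) else 0

/-- The limit value `ζ_{H,j}`: `2π log 2` if `j = 2`, `2π (2^{2-j} - 1)/(2-j)` otherwise. -/
noncomputable def zetaHLim (j : ℝ) : ℝ :=
  if j = 2 then 2 * Real.pi * Real.log 2
  else 2 * Real.pi * ((2 : ℝ) ^ (2 - j) - 1) / (2 - j)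

open MeasureTheory in
lemma cell_volume (k : Fin 2 → ℤ) :
    volume {x : ℂ | (![⌊x.re⌋, ⌊x.im⌋] : Fin 2 → ℤ) = k} = 1 ∧
    MeasurableSet {x : ℂ | (![⌊x.re⌋, ⌊x.im⌋] : Fin 2 → ℤ) = k} := by
  have h : {x : ℂ | (![⌊x.re⌋, ⌊x.im⌋] : Fin 2 → ℤ) = k} =
      Complex.measurableEquivRealProd ⁻¹'
        (Set.Ico (k 0 : ℝ) (k 0 + 1) ×ˢ Set.Ico (k 1 : ℝ) (k 1 + 1)) := by
    ext x
    simp only [Set.mem_ofPred_eq, Set.mem_preimage, Complex.measurableEquivRealProd_apply,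
      Set.mem_prod, Set.mem_Ico, funext_iff, Fin.forall_fin_two, Int.floor_eq_iff,
      Matrix.cons_val_zero, Matrix.cons_val_one]
  have hm : MeasurableSet (Set.Ico (k 0 : ℝ) (k 0 + 1) ×ˢ Set.Ico (k 1 : ℝ) (k 1 + 1)) :=
    measurableSet_Ico.prod measurableSet_Ico
  rw [h]
  refine ⟨?_, Complex.measurableEquivRealProd.measurable hm⟩
  rw [Complex.volume_preserving_equiv_real_prod.measure_preimage hm.nullMeasurableSet,
    Measure.volume_eq_prod, Measure.prod_prod]
  simp

open MeasureTheory in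
lemma sum_eq_integral (h : (Fin 2 → ℤ) → ℝ) (S : Finset (Fin 2 → ℤ))
    (hS : ∀ k, k ∉ S → h k = 0) :
    Integrable (fun x : ℂ => h ![⌊x.re⌋, ⌊x.im⌋]) ∧
      ∫ x : ℂ, h ![⌊x.re⌋, ⌊x.im⌋] = ∑ k ∈ S, h k := by
  have e : (fun x : ℂ => h ![⌊x.re⌋, ⌊x.im⌋]) = fun x => ∑ k ∈ S,
      Set.indicator {x : ℂ | (![⌊x.re⌋, ⌊x.im⌋] : Fin 2 → ℤ) = k} (fun _ => h k) x := by
    funext x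
    simp only [Set.indicator_apply, Set.mem_ofPred_eq]
    rw [Finset.sum_ite_eq]
    split_ifs with hx
    · rfl
    · exact hS _ hx
  have hi : ∀ k ∈ S, Integrable (Set.indicator
      {x : ℂ | (![⌊x.re⌋, ⌊x.im⌋] : Fin 2 → ℤ) = k} (fun _ => h k)) := by
    intro k _
    rw [integrable_indicator_iff (cell_volume k).2]
    exact integrableOn_const (by rw [(cell_volume k).1]; simp)
  rw [e]
  refine ⟨integrable_finsetSum _ hi, ?_⟩
  rw [integral_finsetSum _ hi]
  refine Finset.sum_congr rfl fun k _ => ?_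
  rw [integral_indicator_const _ (cell_volume k).2, Measure.real, (cell_volume k).1]
  simp

lemma nrm2_floor (x : ℂ) : |nrm2 ![⌊x.re⌋, ⌊x.im⌋] - ‖x‖| ≤ 2 := by
  have : nrm2 ![⌊x.re⌋, ⌊x.im⌋] = ‖(⟨⌊x.re⌋, ⌊x.im⌋⟩ : ℂ)‖ := by
    rw [Complex.norm_def, Complex.normSq_apply, nrm2]
    simp [sq]
  rw [this]
  refine (abs_norm_sub_norm_le _ _).trans ((Complex.norm_le_abs_re_add_abs_im _).trans ?_)
  have h1 := Int.floor_le x.re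
  have h2 := Int.lt_floor_add_one x.re
  have h3 := Int.floor_le x.im
  have h4 := Int.lt_floor_add_one x.im
  have a1 : |(⌊x.re⌋ : ℝ) - x.re| ≤ 1 := by rw [abs_le]; constructor <;> linarith
  have a2 : |(⌊x.im⌋ : ℝ) - x.im| ≤ 1 := by rw [abs_le]; constructor <;> linarith
  simp only [Complex.sub_re, Complex.sub_im]
  linarith

open MeasureTheory in
lemma radial (f : ℝ → ℝ) :
    ∫ x : ℂ, f ‖x‖ = 2 * Real.pi * ∫ y in Set.Ioi (0 : ℝ), y * f y := by
  rw [integral_fun_norm_addHaar (volume : Measure ℂ) f]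
  simp [Complex.finrank_real_complex, Measure.real, Complex.volume_ball]
  ring

open MeasureTheory in
lemma ring_bound (a b c : ℝ) (hab : a ≤ b) (hb : 0 ≤ b) (hc : 0 ≤ c) :
    Integrable (fun x : ℂ => Set.indicator (Set.Icc a b) (fun _ => c) ‖x‖) ∧
      ∫ x : ℂ, Set.indicator (Set.Icc a b) (fun _ => c) ‖x‖ ≤ 2 * Real.pi * (b * c * (b - a)) := by
  constructor
  · have : (fun x : ℂ => Set.indicator (Set.Icc a b) (fun _ => c) ‖x‖) =
        Set.indicator ((fun x : ℂ => ‖x‖) ⁻¹' Set.Icc a b) (fun _ => c) := by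
      funext x; simp [Set.indicator_apply]
    rw [this, integrable_indicator_iff (measurable_norm measurableSet_Icc)]
    refine integrableOn_const ?_
    refine ne_top_of_le_ne_top (b := volume (Metric.closedBall (0 : ℂ) b))
      measure_closedBall_lt_top.ne (measure_mono ?_)
    intro x hx
    simpa using hx.2
  · rw [radial]
    refine mul_le_mul_of_nonneg_left ?_ (by positivity)
    have hI : Integrable (Set.indicator (Set.Icc a b) (fun _ => b * c)) := by
      rw [integrable_indicator_iff measurableSet_Icc]
      exact integrableOn_const (by simp)
    have hnn : ∀ y, 0 ≤ Set.indicator (Set.Icc a b) (fun _ => b * c) y :=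
      fun y => Set.indicator_nonneg (fun _ _ => by positivity) y
    calc ∫ y in Set.Ioi (0 : ℝ), y * Set.indicator (Set.Icc a b) (fun _ => c) y
        ≤ ∫ y in Set.Ioi (0 : ℝ), Set.indicator (Set.Icc a b) (fun _ => b * c) y := by
          refine integral_mono_of_nonneg ?_ hI.integrableOn ?_
          · refine (ae_restrict_iff' measurableSet_Ioi).2 (Filter.Eventually.of_forall ?_)
            intro y hy
            exact mul_nonneg (le_of_lt hy) (Set.indicator_nonneg (fun _ _ => hc) y)
          · refine Filter.Eventually.of_forall fun y => ?_
            simp only [Set.indicator_apply]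
            split_ifs with h
            · exact mul_le_mul_of_nonneg_right h.2 hc
            · simp
      _ ≤ ∫ y, Set.indicator (Set.Icc a b) (fun _ => b * c) y :=
          setIntegral_le_integral hI (Filter.Eventually.of_forall hnn)
      _ = b * c * (b - a) := by
          rw [integral_indicator_const _ measurableSet_Icc]
          simp [Measure.real, hab]; ring

/-- the radial profile -/
noncomputable def prof (j : ℝ) (n : ℝ) (r : ℝ) : ℝ :=
  if n ≤ r ∧ r ≤ 2 * n then r ^ (-j) else 0

lemma rpow_lip (j n : ℝ) (hj : 0 ≤ j) (hn : 1 ≤ n) (r s : ℝ) (hr : n ≤ r) (hs : n ≤ s) :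
    |s ^ (-j) - r ^ (-j)| ≤ j * n ^ (-j - 1) * |s - r| := by
  have := Convex.norm_image_sub_le_of_norm_hasDerivWithin_le (f := fun x : ℝ => x ^ (-j))
    (f' := fun x => (-j) * x ^ (-j - 1)) (s := Set.Ici n) (C := j * n ^ (-j - 1)) (x := r) (y := s)
    (fun x hx => (Real.hasDerivAt_rpow_const
      (Or.inl (by have : n ≤ x := hx; linarith))).hasDerivWithinAt) ?_ (convex_Ici n) hr hs
  · simpa [Real.norm_eq_abs] using this
  · intro x hx
    have hx : n ≤ x := hx
    rw [norm_mul, norm_neg, Real.norm_of_nonneg hj,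
      Real.norm_of_nonneg (Real.rpow_nonneg (by linarith) _)]
    exact mul_le_mul_of_nonneg_left
      (Real.rpow_le_rpow_of_nonpos (by linarith) hx (by linarith)) hj

lemma prof_bound (j n : ℝ) (hj : 0 ≤ j) (hn : 1 ≤ n) (r s : ℝ) (h : |s - r| ≤ 2) :
    |prof j n s - prof j n r| ≤
      Set.indicator (Set.Icc 0 (2 * n)) (fun _ => 2 * j * n ^ (-j - 1)) r +
      Set.indicator (Set.Icc (n - 2) (n + 2)) (fun _ => n ^ (-j)) r +
      Set.indicator (Set.Icc (2 * n - 2) (2 * n + 2)) (fun _ => n ^ (-j)) r := by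
  have p1 : 0 ≤ n ^ (-j) := Real.rpow_nonneg (by linarith) _
  have p2 : 0 ≤ 2 * j * n ^ (-j - 1) :=
    mul_nonneg (by linarith) (Real.rpow_nonneg (by linarith) _)
  have n1 : 0 ≤ Set.indicator (Set.Icc 0 (2 * n)) (fun _ => 2 * j * n ^ (-j - 1)) r :=
    Set.indicator_nonneg (fun _ _ => p2) r
  have n2 : 0 ≤ Set.indicator (Set.Icc (n - 2) (n + 2)) (fun _ => n ^ (-j)) r :=
    Set.indicator_nonneg (fun _ _ => p1) r
  have n3 : 0 ≤ Set.indicator (Set.Icc (2 * n - 2) (2 * n + 2)) (fun _ => n ^ (-j)) r :=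
    Set.indicator_nonneg (fun _ _ => p1) r
  have hle : ∀ t, n ≤ t → |t ^ (-j)| ≤ n ^ (-j) := fun t ht => by
    rw [abs_of_nonneg (Real.rpow_nonneg (by linarith) _)]
    exact Real.rpow_le_rpow_of_nonpos (by linarith) ht (by linarith)
  obtain ⟨ha, hb⟩ := abs_le.1 h
  have key : ∀ v : ℝ, v ≤ n ^ (-j) →
      ((n - 2 ≤ r ∧ r ≤ n + 2) ∨ (2 * n - 2 ≤ r ∧ r ≤ 2 * n + 2)) →
      v ≤ Set.indicator (Set.Icc 0 (2 * n)) (fun _ => 2 * j * n ^ (-j - 1)) r +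
      Set.indicator (Set.Icc (n - 2) (n + 2)) (fun _ => n ^ (-j)) r +
      Set.indicator (Set.Icc (2 * n - 2) (2 * n + 2)) (fun _ => n ^ (-j)) r := by
    rintro v hv (hr | hr)
    · have : Set.indicator (Set.Icc (n - 2) (n + 2)) (fun _ => n ^ (-j)) r = n ^ (-j) :=
        Set.indicator_of_mem (Set.mem_Icc.2 hr) _
      linarith
    · have : Set.indicator (Set.Icc (2 * n - 2) (2 * n + 2)) (fun _ => n ^ (-j)) r = n ^ (-j) :=
        Set.indicator_of_mem (Set.mem_Icc.2 hr) _
      linarith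
  unfold prof
  by_cases hs : n ≤ s ∧ s ≤ 2 * n <;> by_cases hr : n ≤ r ∧ r ≤ 2 * n
  · rw [if_pos hs, if_pos hr]
    have h1 := rpow_lip j n hj hn r s hr.1 hs.1
    have : Set.indicator (Set.Icc 0 (2 * n)) (fun _ => 2 * j * n ^ (-j - 1)) r
        = 2 * j * n ^ (-j - 1) :=
      Set.indicator_of_mem (Set.mem_Icc.2 ⟨by linarith, hr.2⟩) _
    have h2 : j * n ^ (-j - 1) * |s - r| ≤ j * n ^ (-j - 1) * 2 :=
      mul_le_mul_of_nonneg_left h (by linarith)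
    linarith
  · rw [if_pos hs, if_neg hr, sub_zero]
    refine key _ (hle s hs.1) ?_
    by_cases h1 : n ≤ r
    · have : 2 * n < r := by by_contra h2; exact hr ⟨h1, not_lt.1 h2⟩
      right; constructor <;> linarith
    · left; constructor <;> linarith
  · rw [if_neg hs, if_pos hr, zero_sub, abs_neg]
    refine key _ (hle r hr.1) ?_
    by_cases h1 : n ≤ s
    · have : 2 * n < s := by by_contra h2; exact hs ⟨h1, not_lt.1 h2⟩
      right; constructor <;> linarith
    · left; constructor <;> linarith
  · rw [if_neg hs, if_neg hr]
    simp only [sub_zero, abs_zero]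
    linarith

open MeasureTheory in
lemma prof_main (j n : ℝ) (hn : 1 ≤ n) :
    Integrable (fun x : ℂ => prof j n ‖x‖) ∧
    ∫ x : ℂ, prof j n ‖x‖ = n ^ (2 - j) * zetaHLim j := by
  have h0 : (0 : ℝ) < n := by linarith
  constructor
  · have e : (fun x : ℂ => prof j n ‖x‖) =
        Set.indicator ((fun x : ℂ => ‖x‖) ⁻¹' Set.Icc n (2 * n)) (fun x => ‖x‖ ^ (-j)) := by
      funext x; simp [Set.indicator_apply, prof]
    rw [e, integrable_indicator_iff (measurable_norm measurableSet_Icc)]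
    apply ContinuousOn.integrableOn_compact
    · refine Metric.isCompact_of_isClosed_isBounded (isClosed_Icc.preimage continuous_norm) ?_
      refine (Metric.isBounded_closedBall (x := (0 : ℂ)) (r := 2 * n)).subset ?_
      intro x hx
      simpa using hx.2
    · intro x hx
      refine ContinuousAt.continuousWithinAt ?_
      refine continuous_norm.continuousAt.rpow_const (Or.inl ?_)
      have : n ≤ ‖x‖ := hx.1
      linarith
  · rw [radial]
    have e : ∫ y in Set.Ioi (0 : ℝ), y * prof j n y = ∫ y in n..(2 * n), y ^ (1 - j) := by
      rw [intervalIntegral.integral_of_le (by linarith), ← integral_Icc_eq_integral_Ioc,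
        ← integral_indicator measurableSet_Icc, ← integral_indicator measurableSet_Ioi]
      congr 1
      funext y
      simp only [Set.indicator_apply, Set.mem_Ioi, Set.mem_Icc, prof]
      by_cases hy : n ≤ y ∧ y ≤ 2 * n
      · have : 0 < y := by linarith [hy.1]
        rw [if_pos this, if_pos hy, if_pos hy, sub_eq_add_neg, Real.rpow_add this, Real.rpow_one]
      · rw [if_neg hy, if_neg hy]; simp
    rw [e, zetaHLim]
    split_ifs with h
    · subst h
      have : ∀ y : ℝ, y ^ ((1 : ℝ) - 2) = y⁻¹ := fun y => by
        rw [← Real.rpow_neg_one]; norm_num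
      simp_rw [this]
      rw [integral_inv_of_pos h0 (by linarith), mul_div_assoc, div_self h0.ne']
      simp
    · have h2 : 2 - j ≠ 0 := fun h' => h (by linarith)
      rw [integral_rpow]
      · rw [show 1 - j + 1 = 2 - j by ring, Real.mul_rpow (by norm_num) h0.le]
        field_simp
      · right
        refine ⟨fun h' => h (by linarith), ?_⟩
        rw [Set.uIcc_of_le (by linarith)]
        exact fun h' => by linarith [h'.1]

open MeasureTheory in
lemma main_bound (j : ℝ) (hj : 0 ≤ j) (n : ℕ) (hn1 : 1 ≤ n) :
    |zetaH n j - zetaHLim j| ≤ (2 * Real.pi * (8 * j + 28)) / n := by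
  have hn : (1 : ℝ) ≤ n := by exact_mod_cast hn1
  have h0 : (0 : ℝ) < n := by linarith
  have hz : zetaH n j = (n : ℝ) ^ (j - 2) * ∑' k : Fin 2 → ℤ, prof j n (nrm2 k) := by
    unfold zetaH
    congr 1
    refine tsum_congr fun k => ?_
    unfold prof
    have : (k ≠ 0 ∧ (n : ℝ) ≤ nrm2 k ∧ nrm2 k ≤ 2 * n) ↔ ((n : ℝ) ≤ nrm2 k ∧ nrm2 k ≤ 2 * n) := by
      refine ⟨fun h => h.2, fun h => ⟨?_, h⟩⟩
      rintro rfl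
      have h1 := h.1
      simp [nrm2] at h1
      linarith
    simp only [this]
  set S : Finset (Fin 2 → ℤ) := Fintype.piFinset fun _ => Finset.Icc (-(2 * n : ℤ)) (2 * n)
  have hS : ∀ k, k ∉ S → prof j n (nrm2 k) = 0 := by
    intro k hk
    unfold prof
    refine if_neg fun h => hk ?_
    have h2 := h.2
    have hq : (k 0 : ℝ) ^ 2 + (k 1 : ℝ) ^ 2 ≤ (2 * n) ^ 2 := by
      unfold nrm2 at h2
      rwa [Real.sqrt_le_left (by linarith)] at h2
    have c : ∀ i, -(2 * n : ℤ) ≤ k i ∧ k i ≤ 2 * n := by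
      intro i
      have : (k i : ℝ) ^ 2 ≤ (2 * n) ^ 2 := by
        fin_cases i
        · have := sq_nonneg (k 1 : ℝ); simp only [Fin.zero_eta]; linarith
        · have := sq_nonneg (k 0 : ℝ); simp only [Fin.mk_one]; linarith
      obtain ⟨u, v⟩ := abs_le.1 (abs_le_of_sq_le_sq this (by linarith))
      exact ⟨by exact_mod_cast u, by exact_mod_cast v⟩
    simp only [S, Fintype.mem_piFinset, Finset.mem_Icc]
    exact c
  obtain ⟨i1, e1⟩ := sum_eq_integral (fun k => prof j n (nrm2 k)) S hS
  obtain ⟨i2, e2⟩ := prof_main j n hn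
  have p1 : 0 ≤ (n : ℝ) ^ (-j) := Real.rpow_nonneg h0.le _
  have p2 : 0 ≤ 2 * j * (n : ℝ) ^ (-j - 1) :=
    mul_nonneg (by linarith) (Real.rpow_nonneg h0.le _)
  obtain ⟨g1, b1⟩ := ring_bound 0 (2 * n) _ (by linarith) (by linarith) p2
  obtain ⟨g2, b2⟩ := ring_bound (n - 2) (n + 2) _ (by linarith) (by linarith) p1
  obtain ⟨g3, b3⟩ := ring_bound (2 * n - 2) (2 * n + 2) _ (by linarith) (by linarith) p1
  have hd : |∑ k ∈ S, prof j n (nrm2 k) - (n : ℝ) ^ (2 - j) * zetaHLim j| ≤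
      2 * Real.pi * (2 * n * (2 * j * (n : ℝ) ^ (-j - 1)) * (2 * n - 0)) +
      2 * Real.pi * ((n + 2) * (n : ℝ) ^ (-j) * (n + 2 - (n - 2))) +
      2 * Real.pi * ((2 * n + 2) * (n : ℝ) ^ (-j) * (2 * n + 2 - (2 * n - 2))) := by
    rw [← e1, ← e2, ← integral_sub i1 i2]
    refine (abs_integral_le_integral_abs).trans ?_
    refine (integral_mono (i1.sub i2).abs ((g1.add g2).add g3)
      (fun x => prof_bound j n hj hn ‖x‖ _ (nrm2_floor x))).trans ?_
    have := integral_add (g1.add g2) g3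
    have h' := integral_add g1 g2
    simp only [Pi.add_apply] at this h' ⊢
    linarith
  rw [hz, tsum_eq_sum (fun k hk => hS k hk)]
  have hp : (n : ℝ) ^ (j - 2) * (n : ℝ) ^ (2 - j) = 1 := by
    rw [← Real.rpow_add h0]; simp
  have hq1 : (n : ℝ) ^ (j - 2) * (n : ℝ) ^ (-j) = 1 / (n : ℝ) ^ 2 := by
    rw [← Real.rpow_add h0, show j - 2 + -j = -(2 : ℝ) by ring, Real.rpow_neg h0.le]
    simp
  have hq2 : (n : ℝ) ^ (j - 2) * (n : ℝ) ^ (-j - 1) = 1 / (n : ℝ) ^ 3 := by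
    rw [← Real.rpow_add h0, show j - 2 + (-j - 1) = -(3 : ℝ) by ring, Real.rpow_neg h0.le]
    norm_cast
    simp
  have pp : 0 ≤ (n : ℝ) ^ (j - 2) := Real.rpow_nonneg h0.le _
  have : (n : ℝ) ^ (j - 2) * ∑ k ∈ S, prof j n (nrm2 k) - zetaHLim j =
      (n : ℝ) ^ (j - 2) * (∑ k ∈ S, prof j n (nrm2 k) - (n : ℝ) ^ (2 - j) * zetaHLim j) := by
    rw [mul_sub, ← mul_assoc, hp, one_mul]
  rw [this, abs_mul, abs_of_nonneg pp]
  refine (mul_le_mul_of_nonneg_left hd pp).trans ?_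
  have e3 : (n : ℝ) ^ (j - 2) *
      (2 * Real.pi * (2 * n * (2 * j * (n : ℝ) ^ (-j - 1)) * (2 * n - 0)) +
      2 * Real.pi * ((n + 2) * (n : ℝ) ^ (-j) * (n + 2 - (n - 2))) +
      2 * Real.pi * ((2 * n + 2) * (n : ℝ) ^ (-j) * (2 * n + 2 - (2 * n - 2)))) =
      2 * Real.pi * (8 * j * n ^ 2 * ((n : ℝ) ^ (j - 2) * (n : ℝ) ^ (-j - 1)) +
        (12 * n + 16) * ((n : ℝ) ^ (j - 2) * (n : ℝ) ^ (-j))) := by ring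
  rw [e3, hq1, hq2, mul_div_assoc]
  refine mul_le_mul_of_nonneg_left ?_ (by positivity)
  rw [show 8 * j * (n : ℝ) ^ 2 * (1 / (n : ℝ) ^ 3) + (12 * n + 16) * (1 / (n : ℝ) ^ 2) =
    (8 * j * n + (12 * n + 16)) / (n : ℝ) ^ 2 by field_simp]
  rw [div_le_div_iff₀ (by positivity) h0]
  nlinarith [mul_nonneg h0.le (sub_nonneg.2 hn)]

/-- For `j ≥ 0`, the 2D Riemann sum `ζ^n_{H,j}` converges to `ζ_{H,j}` with rate `O(n⁻¹)`. -/
theorem riemann_sum_annulus_2d (j : ℝ) (hj : 0 ≤ j) :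
    ∃ C > 0, ∀ n : ℕ, 1 ≤ n → |zetaH n j - zetaHLim j| ≤ C / n := by
  refine ⟨2 * Real.pi * (8 * j + 28), by positivity, fun n hn => main_bound j hj n hn⟩
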